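/- arXiv:1208.4488 — 4 statements merged into one kernel-verified Lean document; each statement's English description precedes it below -/
import Mathlib

section
/- Let G be a group with identity 1, N an abelian normal subgroup of G, q : G → G/N the quotient homomorphism, c : G/N → G a set-theoretic section of q (q(c(x)) = x for all x ∈ G/N) with c(1) = 1, and χ : N → 𝕋 a group homomorphism. Let G_χ = {s ∈ G : χ(sns⁻¹) = χ(n) for all n ∈ N}. Then for all s,t ∈ G_χ one has ω_χ(s,t) = χ( c(q(s))⁻¹ · c(q(st)) · c(q(t))⁻¹ ), where the element c(q(s))⁻¹ c(q(st)) c(q(t))⁻¹ indeed lies in N. -/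
/-- For a section `c` of the quotient map `G → G/N`, the element `c(q s)⁻¹ s` lies in `N`. -/
lemma secDiff_mem {G : Type*} [Group G] (N : Subgroup G) (c : G ⧸ N → G)
    (hc : ∀ x : G ⧸ N, ((c x : G) : G ⧸ N) = x) (s : G) :
    (c ((s : G) : G ⧸ N))⁻¹ * s ∈ N :=
  QuotientGroup.eq.mp (hc ((s : G) : G ⧸ N))

/-- The Borel extension `χ̃(s) = χ(c(q s)⁻¹ s)` of a character `χ` of `N` to `G`. -/
def chiTilde {G : Type*} [Group G] (N : Subgroup G) (c : G ⧸ N → G)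
    (hc : ∀ x : G ⧸ N, ((c x : G) : G ⧸ N) = x) (χ : ↥N → ℂ) (s : G) : ℂ :=
  χ ⟨(c ((s : G) : G ⧸ N))⁻¹ * s, secDiff_mem N c hc s⟩

/-- The multiplier `ω_χ(s,t) = χ̃(s)·χ̃(t)·χ̃(st)⁻¹`. -/
noncomputable def omegaChi {G : Type*} [Group G] (N : Subgroup G) (c : G ⧸ N → G)
    (hc : ∀ x : G ⧸ N, ((c x : G) : G ⧸ N) = x) (χ : ↥N → ℂ) (s t : G) : ℂ :=
  chiTilde N c hc χ s * chiTilde N c hc χ t * (chiTilde N c hc χ (s * t))⁻¹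

/-- If `N` is an abelian normal subgroup of `G`, `χ : N → 𝕋` a character
and `s, t` lie in the stabilizer `G_χ`, then
`ω_χ(s,t) = χ(c(q s)⁻¹ · c(q(st)) · c(q t)⁻¹)`, the argument lying in `N`. -/
theorem stmt_7
    {G : Type*} [Group G] (N : Subgroup G) (hN : N.Normal)
    (habel : ∀ a b : G, a ∈ N → b ∈ N → a * b = b * a)
    (c : G ⧸ N → G) (hc : ∀ x : G ⧸ N, ((c x : G) : G ⧸ N) = x)
    (hc1 : c 1 = 1)
    (χ : ↥N → ℂ) (hχ_hom : ∀ n m : ↥N, χ (n * m) = χ n * χ m)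
    (hχ_norm : ∀ n : ↥N, ‖χ n‖ = 1) :
    ∀ s t : G,
      (∀ n : ↥N, χ ⟨s * ↑n * s⁻¹, hN.conj_mem ↑n n.2 s⟩ = χ n) →
      (∀ n : ↥N, χ ⟨t * ↑n * t⁻¹, hN.conj_mem ↑n n.2 t⟩ = χ n) →
      ∃ hmem : (c ((s : G) : G ⧸ N))⁻¹ * c (((s * t : G) : G ⧸ N)) *
          (c ((t : G) : G ⧸ N))⁻¹ ∈ N,
        omegaChi N c hc χ s t =
          χ ⟨(c ((s : G) : G ⧸ N))⁻¹ * c (((s * t : G) : G ⧸ N)) *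
              (c ((t : G) : G ⧸ N))⁻¹, hmem⟩ := by
  intro s t _ ht
  let a : ↥N := ⟨(c (s : G ⧸ N))⁻¹ * s, secDiff_mem N c hc s⟩
  let b : ↥N := ⟨(c (t : G ⧸ N))⁻¹ * t, secDiff_mem N c hc t⟩
  let d : ↥N := ⟨(c ((s * t : G) : G ⧸ N))⁻¹ * (s * t), secDiff_mem N c hc (s * t)⟩
  let e : ↥N := ⟨t * ↑(d⁻¹ * b) * t⁻¹, hN.conj_mem _ (d⁻¹ * b).2 t⟩
  have key : (c (s : G ⧸ N))⁻¹ * c ((s * t : G) : G ⧸ N) * (c (t : G ⧸ N))⁻¹ = ↑(a * e) := by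
    simp only [a, b, d, e, Subgroup.coe_mul, Subgroup.coe_inv]
    group
  have hmem : (c (s : G ⧸ N))⁻¹ * c ((s * t : G) : G ⧸ N) * (c (t : G ⧸ N))⁻¹ ∈ N :=
    key ▸ (a * e).2
  have hd : χ d ≠ 0 := norm_ne_zero_iff.mp (by simp [hχ_norm])
  have hdb : χ d * χ (d⁻¹ * b) = χ b := by rw [← hχ_hom, mul_inv_cancel_left]
  have he : χ e = χ (d⁻¹ * b) := ht (d⁻¹ * b)
  refine ⟨hmem, ?_⟩
  rw [show (⟨_, hmem⟩ : ↥N) = a * e from Subtype.ext key, hχ_hom, he]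
  change χ a * χ b * (χ d)⁻¹ = χ a * χ (d⁻¹ * b)
  rw [← hdb]
  field_simp
end

section
/- Let G be a group with identity 1, N an abelian normal subgroup of G, q : G → G/N the quotient homomorphism, c : G/N → G a set-theoretic section of q with c(1) = 1, and χ : N → 𝕋 a group homomorphism. Let G_χ = {s ∈ G : χ(sns⁻¹) = χ(n) for all n ∈ N}. Then N ⊆ G_χ, G_χ is a subgroup of G, and ω_χ factors through G_χ/N: for all s,t ∈ G_χ and all n,m ∈ N, ω_χ(sn, tm) = ω_χ(s,t). -/
lemma chiTilde_mul_coe {G : Type*} [Group G] (N : Subgroup G) (c : G ⧸ N → G)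
    (hc : ∀ x : G ⧸ N, ((c x : G) : G ⧸ N) = x)
    (χ : ↥N → ℂ) (hχ_hom : ∀ n m : ↥N, χ (n * m) = χ n * χ m) (s : G) (n : ↥N) :
    chiTilde N c hc χ (s * ↑n) = chiTilde N c hc χ s * χ n := by
  have hq : ((s * ↑n : G) : G ⧸ N) = (s : G ⧸ N) := QuotientGroup.mk_mul_of_mem s n.2
  unfold chiTilde
  rw [← hχ_hom]
  refine congrArg χ (Subtype.ext ?_)
  simp only [hq, Subgroup.coe_mul, mul_assoc]

/-- `N ⊆ G_χ`, `G_χ` is a subgroup of `G`, and the multiplier `ω_χ`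
factors through `G_χ/N`: `ω_χ(sn, tm) = ω_χ(s,t)` for `s, t ∈ G_χ` and `n, m ∈ N`. -/
theorem stmt_8
    {G : Type*} [Group G] (N : Subgroup G) (hN : N.Normal)
    (habel : ∀ a b : G, a ∈ N → b ∈ N → a * b = b * a)
    (c : G ⧸ N → G) (hc : ∀ x : G ⧸ N, ((c x : G) : G ⧸ N) = x)
    (hc1 : c 1 = 1)
    (χ : ↥N → ℂ) (hχ_hom : ∀ n m : ↥N, χ (n * m) = χ n * χ m)
    (hχ_norm : ∀ n : ↥N, ‖χ n‖ = 1) :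
    (∀ n m : ↥N, χ ⟨↑n * ↑m * (↑n : G)⁻¹, hN.conj_mem ↑m m.2 ↑n⟩ = χ m) ∧
    (∃ Gchi : Subgroup G, ∀ s : G,
      s ∈ Gchi ↔ ∀ n : ↥N, χ ⟨s * ↑n * s⁻¹, hN.conj_mem ↑n n.2 s⟩ = χ n) ∧
    (∀ s t : G,
      (∀ n : ↥N, χ ⟨s * ↑n * s⁻¹, hN.conj_mem ↑n n.2 s⟩ = χ n) →
      (∀ n : ↥N, χ ⟨t * ↑n * t⁻¹, hN.conj_mem ↑n n.2 t⟩ = χ n) →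
      ∀ n m : ↥N,
        omegaChi N c hc χ (s * ↑n) (t * ↑m) = omegaChi N c hc χ s t) := by
  refine ⟨fun n m => congrArg χ (Subtype.ext ?_), ⟨
    { carrier := {s | ∀ n : ↥N, χ ⟨s * ↑n * s⁻¹, hN.conj_mem ↑n n.2 s⟩ = χ n}
      one_mem' := fun n => congrArg χ (Subtype.ext (by simp))
      mul_mem' := fun {s t} hs ht n => ?_
      inv_mem' := fun {s} hs n => ?_ }, fun s => Iff.rfl⟩, fun s t _ ht n m => ?_⟩
  · simp [habel n m n.2 m.2]
  · rw [← ht n, ← hs ⟨t * ↑n * t⁻¹, hN.conj_mem ↑n n.2 t⟩]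
    exact congrArg χ (Subtype.ext (by simp [mul_assoc]))
  · rw [← hs ⟨s⁻¹ * ↑n * s⁻¹⁻¹, hN.conj_mem ↑n n.2 s⁻¹⟩]
    exact congrArg χ (Subtype.ext (by simp [mul_assoc]))
  · have hχ_ne (k : ↥N) : χ k ≠ 0 := norm_ne_zero_iff.mp (by simp [hχ_norm k])
    let k : ↥N := ⟨t⁻¹ * ↑n * t⁻¹⁻¹, hN.conj_mem ↑n n.2 t⁻¹⟩
    have hk : χ k = χ n := by
      rw [← ht k]
      exact congrArg χ (Subtype.ext (by simp [k, mul_assoc]))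
    have hst : s * ↑n * (t * ↑m) = s * t * ↑(k * m) := by
      simp [k, mul_assoc]
    have hst_ne : chiTilde N c hc χ (s * t) ≠ 0 := hχ_ne _
    have hn := hχ_ne n
    have hm := hχ_ne m
    unfold omegaChi
    rw [hst]
    simp only [chiTilde_mul_coe N c hc χ hχ_hom, hχ_hom, hk]
    field_simp
end

section
/- With D₄, M, v and the section c : D₄ → M as in the context, for every X, Y ∈ D₄ the element c(X)⁻¹ c(XY) c(Y)⁻¹ of M has the form (∂c(X,Y), E), where ∂c(X,Y) ∈ ℝ² is given by: ∂c(X,Y) = 0 if Y ∈ ⟨R⟩; ∂c(X,Y) = X⁻¹v − v if Y ∈ S⟨R⟩ and X ∈ ⟨R⟩; and ∂c(X,Y) = −(X⁻¹v + v) if both X, Y ∈ S⟨R⟩. Moreover ∂c(X,Y) always lies in ℤ². -/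
noncomputable section
open Matrix

abbrev Mat2 : Type := Matrix (Fin 2) (Fin 2) ℝ

/-- The rotation `R` by `π/2` as a unit of the matrix ring. -/
def RU : Mat2ˣ where
  val := !![0, -1; 1, 0]
  inv := !![0, 1; -1, 0]
  val_inv := by rw [Matrix.one_fin_two]; norm_num [Matrix.mul_fin_two]
  inv_val := by rw [Matrix.one_fin_two]; norm_num [Matrix.mul_fin_two]

/-- The reflection `S` as a unit of the matrix ring. -/
def SU : Mat2ˣ where
  val := !![1, 0; 0, -1]
  inv := !![1, 0; 0, -1]
  val_inv := by rw [Matrix.one_fin_two]; norm_num [Matrix.mul_fin_two]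
  inv_val := by rw [Matrix.one_fin_two]; norm_num [Matrix.mul_fin_two]

/-- The semidirect product `M = ℝ² ⋊ GL₂(ℝ)`, with elements written `(a, X)` and
multiplication `(a, X)(b, Y) = (a + Xb, XY)`. -/
@[ext]
structure Motion : Type where
  tr : Fin 2 → ℝ
  mat : Mat2ˣ

namespace Motion

instance : Group Motion where
  mul p q := ⟨p.tr + p.mat.val.mulVec q.tr, p.mat * q.mat⟩
  one := ⟨0, 1⟩
  inv p := ⟨-((↑(p.mat⁻¹) : Mat2).mulVec p.tr), p.mat⁻¹⟩
  mul_assoc a b c := by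
    refine Motion.ext ?_ ?_
    · show (a.tr + a.mat.val.mulVec b.tr) + ((a.mat * b.mat).val).mulVec c.tr =
        a.tr + a.mat.val.mulVec (b.tr + b.mat.val.mulVec c.tr)
      rw [Matrix.mulVec_add, Units.val_mul, ← Matrix.mulVec_mulVec, add_assoc]
    · show a.mat * b.mat * c.mat = a.mat * (b.mat * c.mat)
      exact mul_assoc _ _ _
  one_mul a := by
    refine Motion.ext ?_ ?_
    · show (0 : Fin 2 → ℝ) + (1 : Mat2ˣ).val.mulVec a.tr = a.tr
      simp
    · show 1 * a.mat = a.mat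
      simp
  mul_one a := by
    refine Motion.ext ?_ ?_
    · show a.tr + a.mat.val.mulVec 0 = a.tr
      simp
    · show a.mat * 1 = a.mat
      simp
  inv_mul_cancel a := by
    refine Motion.ext ?_ ?_
    · show -((↑(a.mat⁻¹) : Mat2).mulVec a.tr) + (↑(a.mat⁻¹) : Mat2).mulVec a.tr = 0
      simp
    · show a.mat⁻¹ * a.mat = 1
      simp

end Motion

/-- The rotation subgroup `⟨R⟩ = {E, R, R², R³}` of `D₄`. -/
def rotSet : Set Mat2ˣ := {1, RU, RU ^ 2, RU ^ 3}

/-- The coset of reflections `S⟨R⟩ = {S, SR, SR², SR³}`. -/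
def refSet : Set Mat2ˣ := {SU, SU * RU, SU * RU ^ 2, SU * RU ^ 3}

/-- The dihedral group `D₄` of order 8 generated by `R` and `S`. -/
def D4set : Set Mat2ˣ := rotSet ∪ refSet

/-- The vector `v = (1/2, 1/2)`. -/
def vhalf : Fin 2 → ℝ := ![1/2, 1/2]

namespace Motion

theorem mk_mul_mk (a b : Fin 2 → ℝ) (X Y : Mat2ˣ) :
    (⟨a, X⟩ * ⟨b, Y⟩ : Motion) = ⟨a + X.val.mulVec b, X * Y⟩ := rfl

theorem inv_mk (a : Fin 2 → ℝ) (X : Mat2ˣ) :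
    (⟨a, X⟩ : Motion)⁻¹ = ⟨-((↑(X⁻¹) : Mat2).mulVec a), X⁻¹⟩ := rfl

theorem inv_mul_mul_inv (a b d : Fin 2 → ℝ) (X Y : Mat2ˣ) :
    (⟨a, X⟩ : Motion)⁻¹ * ⟨b, X * Y⟩ * (⟨d, Y⟩ : Motion)⁻¹ =
      ⟨(↑(X⁻¹) : Mat2).mulVec (b - a) - d, 1⟩ := by
  rw [inv_mk, inv_mk, mk_mul_mk, mk_mul_mk, inv_mul_cancel_left, mul_inv_cancel,
    Matrix.mulVec_neg, Matrix.mulVec_mulVec, ← Units.val_mul, mul_inv_cancel,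
    Units.val_one, Matrix.one_mulVec, Matrix.mulVec_sub]
  congr 1
  ext i
  simp only [Pi.add_apply, Pi.sub_apply, Pi.neg_apply]
  ring

end Motion

theorem RU_pow_four : RU ^ 4 = 1 := by
  ext i j
  fin_cases i <;> fin_cases j <;> simp [RU, pow_succ]

theorem SU_mul_SU : SU * SU = 1 := by
  ext i j
  fin_cases i <;> fin_cases j <;> simp [SU]

theorem RU_mul_SU : RU * SU = SU * RU ^ 3 := by
  ext i j
  fin_cases i <;> fin_cases j <;> simp [RU, SU, pow_succ]

theorem RU_pow_mul_SU (k : ℕ) : RU ^ k * SU = SU * RU ^ (3 * k) := by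
  rw [pow_mul]
  exact (show SemiconjBy SU (RU ^ 3) RU from RU_mul_SU.symm).pow_right k |>.symm

theorem RU_pow_mod_four (k : ℕ) : RU ^ (k % 4) = RU ^ k :=
  (pow_eq_pow_mod k RU_pow_four).symm

theorem mem_rotSet_iff {X : Mat2ˣ} : X ∈ rotSet ↔ ∃ k : ℕ, X = RU ^ k := by
  constructor
  · rintro (rfl | rfl | rfl | rfl)
    exacts [⟨0, by simp⟩, ⟨1, by simp⟩, ⟨2, rfl⟩, ⟨3, rfl⟩]
  · rintro ⟨k, rfl⟩
    rw [← RU_pow_mod_four]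
    have hk : k % 4 < 4 := Nat.mod_lt _ (by norm_num)
    interval_cases k % 4 <;> simp [rotSet]

theorem mem_refSet_iff {X : Mat2ˣ} : X ∈ refSet ↔ ∃ k : ℕ, X = SU * RU ^ k := by
  constructor
  · rintro (rfl | rfl | rfl | rfl)
    exacts [⟨0, by simp⟩, ⟨1, by simp⟩, ⟨2, rfl⟩, ⟨3, rfl⟩]
  · rintro ⟨k, rfl⟩
    rw [← RU_pow_mod_four]
    have hk : k % 4 < 4 := Nat.mod_lt _ (by norm_num)
    interval_cases k % 4 <;> simp [refSet]

theorem rot_mul_rot {X Y : Mat2ˣ} (hX : X ∈ rotSet) (hY : Y ∈ rotSet) : X * Y ∈ rotSet := by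
  obtain ⟨k, rfl⟩ := mem_rotSet_iff.1 hX
  obtain ⟨l, rfl⟩ := mem_rotSet_iff.1 hY
  exact mem_rotSet_iff.2 ⟨k + l, (pow_add _ _ _).symm⟩

theorem ref_mul_rot {X Y : Mat2ˣ} (hX : X ∈ refSet) (hY : Y ∈ rotSet) : X * Y ∈ refSet := by
  obtain ⟨k, rfl⟩ := mem_refSet_iff.1 hX
  obtain ⟨l, rfl⟩ := mem_rotSet_iff.1 hY
  exact mem_refSet_iff.2 ⟨k + l, by rw [pow_add, mul_assoc]⟩

theorem rot_mul_ref {X Y : Mat2ˣ} (hX : X ∈ rotSet) (hY : Y ∈ refSet) : X * Y ∈ refSet := by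
  obtain ⟨k, rfl⟩ := mem_rotSet_iff.1 hX
  obtain ⟨l, rfl⟩ := mem_refSet_iff.1 hY
  exact mem_refSet_iff.2 ⟨3 * k + l, by rw [← mul_assoc, RU_pow_mul_SU, mul_assoc, ← pow_add]⟩

theorem ref_mul_ref {X Y : Mat2ˣ} (hX : X ∈ refSet) (hY : Y ∈ refSet) : X * Y ∈ rotSet := by
  obtain ⟨k, rfl⟩ := mem_refSet_iff.1 hX
  obtain ⟨l, rfl⟩ := mem_refSet_iff.1 hY
  refine mem_rotSet_iff.2 ⟨3 * k + l, ?_⟩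
  rw [mul_assoc, ← mul_assoc (RU ^ k), RU_pow_mul_SU, mul_assoc SU, ← pow_add, ← mul_assoc,
    SU_mul_SU, one_mul]

theorem disjoint_rotSet_refSet : Disjoint rotSet refSet := by
  refine Set.disjoint_left.2 fun X hX hX' => ?_
  obtain ⟨k, rfl⟩ := mem_rotSet_iff.1 hX
  obtain ⟨l, hl⟩ := mem_refSet_iff.1 hX'
  have h := congrArg (fun Z : Mat2ˣ => Z.val.det) hl
  have hR : RU.val.det = 1 := by simp [RU]
  have hS : SU.val.det = -1 := by simp [SU]
  simp only [Units.val_mul, Units.val_pow_eq_pow_val, Matrix.det_mul, Matrix.det_pow, hR, hS,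
    one_pow] at h
  norm_num at h

/-- A plane vector whose coordinates are all half-odd integers. -/
def IsHalfOdd (u : Fin 2 → ℝ) : Prop := ∀ i, ∃ n : ℤ, u i = n + 1 / 2

theorem isHalfOdd_vhalf : IsHalfOdd vhalf := fun i => ⟨0, by fin_cases i <;> simp [vhalf]⟩

theorem IsHalfOdd.RU_inv_mulVec {u : Fin 2 → ℝ} (hu : IsHalfOdd u) :
    IsHalfOdd ((↑(RU⁻¹) : Mat2).mulVec u) := by
  have hR : (↑(RU⁻¹) : Mat2) = !![0, 1; -1, 0] := rfl
  obtain ⟨m, hm⟩ := hu 0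
  obtain ⟨n, hn⟩ := hu 1
  rw [hR]
  refine Fin.forall_fin_two.2 ⟨⟨n, ?_⟩, ⟨-m - 1, ?_⟩⟩
  · simp [Matrix.mulVec_eq_sum, hn]
  · simp [Matrix.mulVec_eq_sum, hm]
    ring

theorem IsHalfOdd.SU_inv_mulVec {u : Fin 2 → ℝ} (hu : IsHalfOdd u) :
    IsHalfOdd ((↑(SU⁻¹) : Mat2).mulVec u) := by
  have hS : (↑(SU⁻¹) : Mat2) = !![1, 0; 0, -1] := rfl
  obtain ⟨m, hm⟩ := hu 0
  obtain ⟨n, hn⟩ := hu 1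
  rw [hS]
  refine Fin.forall_fin_two.2 ⟨⟨m, ?_⟩, ⟨-n - 1, ?_⟩⟩
  · simp [Matrix.mulVec_eq_sum, hm]
  · simp [Matrix.mulVec_eq_sum, hn]
    ring

theorem IsHalfOdd.RU_pow_inv_mulVec {u : Fin 2 → ℝ} (hu : IsHalfOdd u) (k : ℕ) :
    IsHalfOdd ((↑((RU ^ k)⁻¹) : Mat2).mulVec u) := by
  induction k with
  | zero => simpa using hu
  | succ k ih =>
    rw [pow_succ, _root_.mul_inv_rev, Units.val_mul, ← Matrix.mulVec_mulVec]
    exact ih.RU_inv_mulVec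

theorem IsHalfOdd.inv_mulVec {u : Fin 2 → ℝ} (hu : IsHalfOdd u) {X : Mat2ˣ} (hX : X ∈ D4set) :
    IsHalfOdd ((↑(X⁻¹) : Mat2).mulVec u) := by
  rcases hX with hX | hX
  · obtain ⟨k, rfl⟩ := mem_rotSet_iff.1 hX
    exact hu.RU_pow_inv_mulVec k
  · obtain ⟨k, rfl⟩ := mem_refSet_iff.1 hX
    rw [_root_.mul_inv_rev, Units.val_mul, ← Matrix.mulVec_mulVec]
    exact hu.SU_inv_mulVec.RU_pow_inv_mulVec k

theorem IsHalfOdd.exists_int_sub {u w : Fin 2 → ℝ} (hu : IsHalfOdd u) (hw : IsHalfOdd w)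
    (i : Fin 2) : ∃ n : ℤ, (u - w) i = n := by
  obtain ⟨m, hm⟩ := hu i
  obtain ⟨n, hn⟩ := hw i
  exact ⟨m - n, by rw [Pi.sub_apply, hm, hn]; push_cast; ring⟩

theorem IsHalfOdd.neg {u : Fin 2 → ℝ} (hu : IsHalfOdd u) : IsHalfOdd (-u) := fun i => by
  obtain ⟨n, hn⟩ := hu i
  exact ⟨-n - 1, by rw [Pi.neg_apply, hn]; push_cast; ring⟩

/-- With `c : D₄ → M` the section `c(X) = (0, X)` for `X ∈ ⟨R⟩` and
`c(X) = (v, X)` for `X ∈ S⟨R⟩`, the element `c(X)⁻¹ c(XY) c(Y)⁻¹` has the form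
`(∂c(X,Y), E)` with `∂c(X,Y)` as stated, and `∂c(X,Y)` always lies in `ℤ²`. -/
theorem stmt_9
    (c : Mat2ˣ → Motion)
    (hcR : ∀ X ∈ rotSet, c X = ⟨0, X⟩)
    (hcS : ∀ X ∈ refSet, c X = ⟨vhalf, X⟩) :
    ∀ X ∈ D4set, ∀ Y ∈ D4set,
      ∃ w : Fin 2 → ℝ,
        (c X)⁻¹ * c (X * Y) * (c Y)⁻¹ = ⟨w, 1⟩ ∧
        (Y ∈ rotSet → w = 0) ∧
        (Y ∈ refSet → X ∈ rotSet → w = (↑(X⁻¹) : Mat2).mulVec vhalf - vhalf) ∧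
        (Y ∈ refSet → X ∈ refSet → w = -((↑(X⁻¹) : Mat2).mulVec vhalf + vhalf)) ∧
        (∀ i, ∃ n : ℤ, w i = (n : ℝ)) := by
  have hdisj {Z : Mat2ˣ} (h : Z ∈ rotSet) (h' : Z ∈ refSet) : False :=
    Set.disjoint_left.1 disjoint_rotSet_refSet h h'
  intro X hX Y hY
  have hXv := isHalfOdd_vhalf.inv_mulVec hX
  rcases hY with hY | hY
  · refine ⟨0, ?_, fun _ => rfl, fun h => (hdisj hY h).elim, fun h => (hdisj hY h).elim,
      fun _ => ⟨0, by simp⟩⟩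
    rcases hX with hX | hX
    · rw [hcR X hX, hcR Y hY, hcR _ (rot_mul_rot hX hY), Motion.inv_mul_mul_inv]
      simp
    · rw [hcS X hX, hcR Y hY, hcS _ (ref_mul_rot hX hY), Motion.inv_mul_mul_inv]
      simp
  · rcases hX with hX | hX
    · refine ⟨(↑(X⁻¹) : Mat2).mulVec vhalf - vhalf, ?_, fun h => (hdisj h hY).elim,
        fun _ _ => rfl, fun _ h => (hdisj hX h).elim, hXv.exists_int_sub isHalfOdd_vhalf⟩
      rw [hcR X hX, hcS Y hY, hcS _ (rot_mul_ref hX hY), Motion.inv_mul_mul_inv, sub_zero]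
    · have hw : -((↑(X⁻¹) : Mat2).mulVec vhalf + vhalf) =
          -((↑(X⁻¹) : Mat2).mulVec vhalf) - vhalf := by abel
      refine ⟨-((↑(X⁻¹) : Mat2).mulVec vhalf + vhalf), ?_, fun h => (hdisj h hY).elim,
        fun _ h => (hdisj h hX).elim, fun _ _ => rfl, ?_⟩
      · rw [hcS X hX, hcS Y hY, hcR _ (ref_mul_ref hX hY), Motion.inv_mul_mul_inv, hw,
          zero_sub, Matrix.mulVec_neg]
      · rw [hw]
        exact hXv.neg.exists_int_sub isHalfOdd_vhalf
end
end

section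
/- With D₄ acting on the torus T² = ℝ²/ℤ² as in the context, and writing [s,t] for the class of (s,t) ∈ ℝ² in T², the stabilizer subgroups in D₄ are: the trivial subgroup {E} at [s,t] whenever 0 < s < t < 1/2; the subgroup {E, SR³} at [s,s] whenever 0 < s < 1/2; the subgroup {E, SR²} at [0,t] whenever 0 < t < 1/2; the subgroup {E, S} at [s,1/2] whenever 0 < s < 1/2; the subgroup {E, R², S, SR²} at [0,1/2]; and all of D₄ at [0,0] and at [1/2,1/2]. -/
noncomputable section
open Matrix

/-- The integer lattice `ℤ² ⊆ ℝ²`. -/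
def intLat : AddSubgroup (Fin 2 → ℝ) where
  carrier := {w | ∀ i, ∃ n : ℤ, w i = (n : ℝ)}
  zero_mem' := fun i => ⟨0, by simp⟩
  add_mem' := by
    rintro a b ha hb i
    obtain ⟨n, hn⟩ := ha i
    obtain ⟨m, hm⟩ := hb i
    exact ⟨n + m, by simp [hn, hm]⟩
  neg_mem' := by
    rintro a ha i
    obtain ⟨n, hn⟩ := ha i
    exact ⟨-n, by simp [hn]⟩

/-- The 2-torus `T² = ℝ²/ℤ²`. -/
abbrev Torus2 : Type := (Fin 2 → ℝ) ⧸ intLat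

/-- The class of `w ∈ ℝ²` in `T²`. -/
abbrev torusMk (w : Fin 2 → ℝ) : Torus2 := QuotientAddGroup.mk w

theorem torusMk_eq_iff (a b c d : ℝ) :
    torusMk ![a, b] = torusMk ![c, d] ↔ (∃ n : ℤ, c - a = n) ∧ ∃ m : ℤ, d - b = m := by
  rw [QuotientAddGroup.eq]
  change (∀ i, ∃ n : ℤ, (-![a, b] + ![c, d]) i = n) ↔ _
  simp [Fin.forall_fin_two, neg_add_eq_sub]

theorem int_trichotomy_cast (n : ℤ) : (n : ℝ) ≤ -1 ∨ (n : ℝ) = 0 ∨ 1 ≤ (n : ℝ) := by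
  have h : n ≤ -1 ∨ n = 0 ∨ 1 ≤ n := by omega
  exact_mod_cast h

theorem RU_val : (RU : Mat2) = !![0, -1; 1, 0] := rfl

theorem SU_val : (SU : Mat2) = !![1, 0; 0, -1] := rfl

theorem RU_sq_val : ((RU ^ 2 : Mat2ˣ) : Mat2) = !![-1, 0; 0, -1] := by
  simp [pow_succ, RU_val]

theorem RU_cube_val : ((RU ^ 3 : Mat2ˣ) : Mat2) = !![0, 1; -1, 0] := by
  simp [pow_succ, RU_val]

theorem SU_mul_RU_val : ((SU * RU : Mat2ˣ) : Mat2) = !![0, -1; -1, 0] := by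
  simp [RU_val, SU_val]

theorem SU_mul_RU_sq_val : ((SU * RU ^ 2 : Mat2ˣ) : Mat2) = !![-1, 0; 0, 1] := by
  rw [Units.val_mul, RU_sq_val, SU_val]; simp

theorem SU_mul_RU_cube_val : ((SU * RU ^ 3 : Mat2ˣ) : Mat2) = !![0, 1; 1, 0] := by
  rw [Units.val_mul, RU_cube_val, SU_val]; simp

theorem one_val : ((1 : Mat2ˣ) : Mat2) = !![1, 0; 0, 1] := by
  rw [Units.val_one, Matrix.one_fin_two]

theorem mulVec_pair (a b c d x y : ℝ) :
    (!![a, b; c, d] : Mat2).mulVec ![x, y] = ![a * x + b * y, c * x + d * y] := by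
  ext i; fin_cases i <;> simp [Matrix.mulVec, dotProduct]

theorem mat2_eq_iff (a b c d a' b' c' d' : ℝ) :
    (!![a, b; c, d] : Mat2) = !![a', b'; c', d'] ↔ (a = a' ∧ b = b') ∧ c = c' ∧ d = d' := by
  simp

theorem forall_mem_D4set {P : Mat2ˣ → Prop} :
    (∀ X ∈ D4set, P X) ↔ (P 1 ∧ P RU ∧ P (RU ^ 2) ∧ P (RU ^ 3)) ∧
      P SU ∧ P (SU * RU) ∧ P (SU * RU ^ 2) ∧ P (SU * RU ^ 3) := by
  simp [D4set, rotSet, refSet, or_imp, forall_and]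
  tauto

theorem torusMk_mulVec_eq_iff (a b c d x y : ℝ) :
    torusMk ((!![a, b; c, d] : Mat2).mulVec ![x, y]) = torusMk ![x, y] ↔
      (∃ n : ℤ, x - (a * x + b * y) = n) ∧ ∃ m : ℤ, y - (c * x + d * y) = m := by
  rw [mulVec_pair, torusMk_eq_iff]

/-- The stabilizers in `D₄` of the points of the fundamental domain
for the action of `D₄` on the torus `T² = ℝ²/ℤ²` by `X·[w] = [Xw]`. -/
theorem stmt_12 :
    (∀ s t : ℝ, 0 < s → s < t → t < 1/2 → ∀ X ∈ D4set,
      (torusMk ((↑X : Mat2).mulVec ![s, t]) = torusMk ![s, t] ↔ X = 1)) ∧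
    (∀ s : ℝ, 0 < s → s < 1/2 → ∀ X ∈ D4set,
      (torusMk ((↑X : Mat2).mulVec ![s, s]) = torusMk ![s, s] ↔
        X = 1 ∨ X = SU * RU ^ 3)) ∧
    (∀ t : ℝ, 0 < t → t < 1/2 → ∀ X ∈ D4set,
      (torusMk ((↑X : Mat2).mulVec ![0, t]) = torusMk ![0, t] ↔
        X = 1 ∨ X = SU * RU ^ 2)) ∧
    (∀ s : ℝ, 0 < s → s < 1/2 → ∀ X ∈ D4set,
      (torusMk ((↑X : Mat2).mulVec ![s, 1/2]) = torusMk ![s, 1/2] ↔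
        X = 1 ∨ X = SU)) ∧
    (∀ X ∈ D4set,
      (torusMk ((↑X : Mat2).mulVec ![0, 1/2]) = torusMk ![0, 1/2] ↔
        X = 1 ∨ X = RU ^ 2 ∨ X = SU ∨ X = SU * RU ^ 2)) ∧
    (∀ X ∈ D4set,
      torusMk ((↑X : Mat2).mulVec ![0, 0]) = torusMk ![0, 0] ∧
      torusMk ((↑X : Mat2).mulVec ![1/2, 1/2]) = torusMk ![1/2, 1/2]) := by
  refine ⟨fun s t h0 hst ht => ?_, fun s h0 hs => ?_, fun t h0 ht => ?_, fun s h0 hs => ?_,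
    ?_, ?_⟩
  all_goals
    rw [forall_mem_D4set]
    simp only [Units.ext_iff, one_val, RU_val, RU_sq_val, RU_cube_val, SU_val, SU_mul_RU_val,
      SU_mul_RU_sq_val, SU_mul_RU_cube_val, torusMk_mulVec_eq_iff, mat2_eq_iff]
    refine ⟨⟨?_, ?_, ?_, ?_⟩, ?_, ?_, ?_, ?_⟩
  all_goals
    first
    | refine iff_of_false ?_ (by norm_num)
      rintro ⟨⟨n, hn⟩, ⟨m, hm⟩⟩
      rcases int_trichotomy_cast n with h | h | h <;>
        rcases int_trichotomy_cast m with h' | h' | h' <;> linarith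
    | refine iff_of_true ⟨?_, ?_⟩ (by norm_num) <;>
        first
        | exact ⟨0, by push_cast; ring1⟩
        | exact ⟨1, by push_cast; ring1⟩
    | refine ⟨⟨?_, ?_⟩, ?_, ?_⟩ <;>
        first
        | exact ⟨0, by push_cast; ring1⟩
        | exact ⟨1, by push_cast; ring1⟩
end
end
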